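/- Let ω : ℕ → ℝ be a nonincreasing sequence of positive numbers with ω_k → 0 and liminf_{k→∞} (2ω_k/ω_{k+1} + (ω_{k+1} − ω_k)/ω_{k+1}²) > 0, let C > 0 and Q > 0 be constants, and let Δ : ℕ → [0, ∞) be a bounded sequence. Then there exist λ₀ > 0 and k₀ ∈ ℕ such that for all λ ≥ λ₀ and all k ≥ k₀, the sequence ψ_k = λ ω_k + 2Q sup_{i ≥ k₀} Δ_i satisfies ψ_{k+1} ≥ (1 − 2ω_{k+1} + Q ω_{k+1}²) ψ_k + 14 C Q ω_{k+1}² + 4 Q Δ_k ω_{k+1}. -/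

import Mathlib

open Filter

/-- A real sequence with positive `liminf` is eventually bounded below by a positive constant;
no boundedness assumption is needed because the junk values of `sSup` are zero. -/
theorem exists_pos_eventually_le_of_liminf_pos {α : Type*} {l : Filter α} {f : α → ℝ}
    (h : 0 < l.liminf f) : ∃ c : ℝ, 0 < c ∧ ∀ᶠ x in l, c ≤ f x := by
  by_contra hneg
  rw [liminf_eq] at h
  refine absurd h (not_lt.mpr (Real.sSup_nonpos fun c hc => ?_))
  by_contra! hpos
  exact hneg ⟨c, hpos, hc⟩

/-- Existence of a dominating supersolution: for nonincreasing positive step sizes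
`ω_k → 0` with `liminf (2ω_k/ω_{k+1} + (ω_{k+1} − ω_k)/ω_{k+1}²) > 0` and a bounded
nonnegative bias sequence `Δ`, there exist `λ₀ > 0` and `k₀` such that for all `λ ≥ λ₀`
and `k ≥ k₀`, the sequence `ψ_k = λ ω_k + 2Q sup_{i ≥ k₀} Δ_i` satisfies
`ψ_{k+1} ≥ (1 − 2ω_{k+1} + Q ω_{k+1}²) ψ_k + 14 C Q ω_{k+1}² + 4 Q Δ_k ω_{k+1}`. -/
theorem exists_supersolution (ω Δ : ℕ → ℝ) (C Q : ℝ) (hC : 0 < C) (hQ : 0 < Q)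
    (hω_pos : ∀ k, 0 < ω k)
    (hω_anti : ∀ k, ω (k + 1) ≤ ω k)
    (hω_lim : Tendsto ω atTop (nhds 0))
    (hliminf : 0 < atTop.liminf
      (fun k => 2 * ω k / ω (k + 1) + (ω (k + 1) - ω k) / ω (k + 1) ^ 2))
    (hΔ_nonneg : ∀ k, 0 ≤ Δ k)
    (hΔ_bdd : ∃ Bd : ℝ, ∀ k, Δ k ≤ Bd) :
    ∃ lam₀ : ℝ, 0 < lam₀ ∧ ∃ k₀ : ℕ, ∀ lam, lam₀ ≤ lam → ∀ k, k₀ ≤ k →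
      lam * ω (k + 1) + 2 * Q * sSup (Δ '' {i | k₀ ≤ i}) ≥
        (1 - 2 * ω (k + 1) + Q * ω (k + 1) ^ 2) *
            (lam * ω k + 2 * Q * sSup (Δ '' {i | k₀ ≤ i})) +
          14 * C * Q * ω (k + 1) ^ 2 + 4 * Q * Δ k * ω (k + 1) := by
  obtain ⟨c, hc, hev⟩ := exists_pos_eventually_le_of_liminf_pos hliminf
  obtain ⟨B, hB⟩ := hΔ_bdd
  have hsmall : ∀ᶠ k in atTop, ω k < c / (2 * Q) :=
    hω_lim.eventually_lt_const (by positivity)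
  obtain ⟨k₀, hk₀⟩ := eventually_atTop.mp (hev.and hsmall)
  have hB0 : 0 ≤ B := (hΔ_nonneg 0).trans (hB 0)
  refine ⟨(2 * Q ^ 2 * B + 14 * C * Q) / (c / 2), by positivity, k₀, fun lam hlam k hk => ?_⟩
  obtain ⟨hratio, hωk⟩ := hk₀ k hk
  rw [div_le_iff₀ (by positivity)] at hlam
  rw [lt_div_iff₀ (by positivity)] at hωk
  have hbdd : BddAbove (Δ '' {i | k₀ ≤ i}) := ⟨B, by rintro _ ⟨i, _, rfl⟩; exact hB i⟩
  have hΔS : Δ k ≤ sSup (Δ '' {i | k₀ ≤ i}) := le_csSup hbdd ⟨k, hk, rfl⟩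
  have hSB : sSup (Δ '' {i | k₀ ≤ i}) ≤ B :=
    csSup_le ⟨Δ k, k, hk, rfl⟩ (by rintro _ ⟨i, _, rfl⟩; exact hB i)
  generalize sSup (Δ '' {i | k₀ ≤ i}) = S at hΔS hSB ⊢
  have hb := hω_pos (k + 1)
  have hlam0 : 0 ≤ lam := by
    have : 0 ≤ lam * (c / 2) := le_trans (by positivity) hlam
    exact nonneg_of_mul_nonneg_left this (by positivity)
  have hdrift : c * ω (k + 1) ^ 2 ≤ 2 * ω k * ω (k + 1) + (ω (k + 1) - ω k) := by
    calc c * ω (k + 1) ^ 2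
        ≤ (2 * ω k / ω (k + 1) + (ω (k + 1) - ω k) / ω (k + 1) ^ 2) * ω (k + 1) ^ 2 := by
          gcongr
      _ = _ := by field_simp
  have hgain : 0 ≤ lam * (2 * ω k * ω (k + 1) + (ω (k + 1) - ω k) - c * ω (k + 1) ^ 2) :=
    mul_nonneg hlam0 (sub_nonneg.mpr hdrift)
  have hstep : 0 ≤ lam * ω (k + 1) ^ 2 * (c / 2 - Q * ω k) :=
    mul_nonneg (by positivity) (by linarith)
  have hconst : 0 ≤ ω (k + 1) ^ 2 * (lam * (c / 2) - (2 * Q ^ 2 * B + 14 * C * Q)) :=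
    mul_nonneg (by positivity) (sub_nonneg.mpr hlam)
  have hbias : 0 ≤ 4 * Q * ω (k + 1) * (S - Δ k) :=
    mul_nonneg (by positivity) (sub_nonneg.mpr hΔS)
  have hsup : 0 ≤ 2 * Q ^ 2 * ω (k + 1) ^ 2 * (B - S) :=
    mul_nonneg (by positivity) (sub_nonneg.mpr hSB)
  linear_combination hgain + hstep + hconst + hbias + hsup
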